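/- Let ε > 0 and b < 0 be real numbers, and let g : (0, ε) → ℂ be continuous with A := ∫₀^ε |g(t)|² t^{1-2b} dt < ∞. Then for every x ∈ (0, ε), g is integrable on (x, ε); define f(x) := -∫ₓ^ε g(t) dt for x ∈ (0, ε). Then HasDerivAt f (g(x)) x for every x ∈ (0, ε), and ∫₀^ε |f(x)|² x^{-2b-1} dx ≤ A / b². -/

import Mathlib

open MeasureTheory

/-- Tonelli on the triangle `a < x < t < c`. -/
theorem lintegral_Ioo_mul_lintegral_Ioo_swap {a c : ℝ} {w h : ℝ → ENNReal} (hw : Measurable w)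
    (hh : AEMeasurable h (volume.restrict (Set.Ioo a c))) :
    ∫⁻ x in Set.Ioo a c, w x * ∫⁻ t in Set.Ioo x c, h t =
      ∫⁻ t in Set.Ioo a c, h t * ∫⁻ x in Set.Ioo a t, w x := by
  have hmeas : MeasurableSet {p : ℝ × ℝ | p.1 < p.2} := measurableSet_lt measurable_fst measurable_snd
  calc
    _ = ∫⁻ x in Set.Ioo a c, ∫⁻ t in Set.Ioo a c,
          {p : ℝ × ℝ | p.1 < p.2}.indicator (fun p => w p.1 * h p.2) (x, t) := by
      refine setLIntegral_congr_fun measurableSet_Ioo fun x hx => ?_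
      have hset : Set.Ioo x c = Set.Ioi x ∩ Set.Ioo a c := by
        ext t
        simp only [Set.mem_Ioo, Set.mem_inter_iff, Set.mem_Ioi]
        exact ⟨fun ht => ⟨ht.1, hx.1.trans ht.1, ht.2⟩, fun ht => ⟨ht.1, ht.2.2⟩⟩
      have hx_meas : AEMeasurable h (volume.restrict (Set.Ioo x c)) :=
        hh.mono_measure (Measure.restrict_mono (Set.Ioo_subset_Ioo_left hx.1.le) le_rfl)
      change w x * _ = _
      rw [← lintegral_const_mul'' _ hx_meas, hset, ← Measure.restrict_restrict measurableSet_Ioi,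
        ← lintegral_indicator measurableSet_Ioi]
      rfl
    _ = ∫⁻ t in Set.Ioo a c, ∫⁻ x in Set.Ioo a c,
          {p : ℝ × ℝ | p.1 < p.2}.indicator (fun p => w p.1 * h p.2) (x, t) :=
      lintegral_lintegral_swap
        (((hw.comp measurable_fst).aemeasurable.mul hh.comp_snd).indicator hmeas)
    _ = _ := by
      refine setLIntegral_congr_fun measurableSet_Ioo fun t ht => ?_
      have hset : Set.Ioo a t = Set.Iio t ∩ Set.Ioo a c := by
        ext x
        simp only [Set.mem_Ioo, Set.mem_inter_iff, Set.mem_Iio]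
        exact ⟨fun hx => ⟨hx.2, hx.1, hx.2.trans ht.2⟩, fun hx => ⟨hx.2.1, hx.1⟩⟩
      change _ = h t * _
      rw [← lintegral_const_mul _ hw, hset, ← Measure.restrict_restrict measurableSet_Iio,
        ← lintegral_indicator measurableSet_Iio]
      simp only [mul_comm (h t)]
      rfl

theorem lintegral_Ioi_rpow_neg {x c : ℝ} (hx : 0 < x) (hc : 0 < c) :
    ∫⁻ t in Set.Ioi x, ENNReal.ofReal (t ^ (-(1 + c))) = ENNReal.ofReal (x ^ (-c) / c) := by
  rw [← ofReal_integral_eq_lintegral_ofReal (integrableOn_Ioi_rpow_of_lt (by linarith) hx)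
    ((ae_restrict_iff' measurableSet_Ioi).2 (ae_of_all _ fun t ht =>
      Real.rpow_nonneg (hx.trans ht).le _)), integral_Ioi_rpow_of_lt (by linarith) hx]
  rw [show -(1 + c) + 1 = -c by ring, neg_div_neg_eq]

theorem lintegral_Ioo_zero_rpow {t c : ℝ} (ht : 0 < t) (hc : 0 < c) :
    ∫⁻ x in Set.Ioo 0 t, ENNReal.ofReal (x ^ (c - 1)) = ENNReal.ofReal (t ^ c / c) := by
  have hint : IntegrableOn (fun x : ℝ => x ^ (c - 1)) (Set.Ioo 0 t) :=
    (intervalIntegral.integrableOn_Ioo_rpow_iff ht).2 (by linarith)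
  rw [← ofReal_integral_eq_lintegral_ofReal hint
    ((ae_restrict_iff' measurableSet_Ioo).2 (ae_of_all _ fun x hx => Real.rpow_nonneg hx.1.le _)),
    ← integral_Ioc_eq_integral_Ioo, ← intervalIntegral.integral_of_le ht.le,
    integral_rpow (Or.inl (by linarith))]
  simp [Real.zero_rpow hc.ne']

/-- Weighted Cauchy–Schwarz bound for the tail integral, with weight `t ^ (1 + c)`. -/
theorem enorm_integral_Ioo_sq_le {E : Type*} [NormedAddCommGroup E] [NormedSpace ℝ E]
    {x ε c : ℝ} (hx : 0 < x) (hc : 0 < c) {g : ℝ → E}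
    (hg : AEStronglyMeasurable g (volume.restrict (Set.Ioo x ε))) :
    ‖∫ t in Set.Ioo x ε, g t‖ₑ ^ 2 ≤ ENNReal.ofReal (x ^ (-c) / c) *
      ∫⁻ t in Set.Ioo x ε, ‖g t‖ₑ ^ 2 * ENNReal.ofReal (t ^ (1 + c)) := by
  set u : ℝ → ENNReal := fun t => ENNReal.ofReal (t ^ (-(1 + c) / 2)) with hu
  set v : ℝ → ENNReal := fun t => ‖g t‖ₑ * ENNReal.ofReal (t ^ ((1 + c) / 2)) with hv
  have hpow : ∀ s : ℝ, ∀ t ∈ Set.Ioo x ε,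
      ENNReal.ofReal (t ^ (s / 2)) ^ 2 = ENNReal.ofReal (t ^ s) := fun s t ht => by
    have ht0 := hx.trans ht.1
    rw [← ENNReal.ofReal_pow (Real.rpow_nonneg ht0.le _), ← Real.rpow_natCast,
      ← Real.rpow_mul ht0.le]
    norm_num
  have huv : ∫⁻ t in Set.Ioo x ε, ‖g t‖ₑ = ∫⁻ t in Set.Ioo x ε, (u * v) t := by
    refine setLIntegral_congr_fun measurableSet_Ioo fun t ht => ?_
    have ht0 := hx.trans ht.1
    simp only [hu, hv, Pi.mul_apply]
    rw [mul_left_comm, ← ENNReal.ofReal_mul (Real.rpow_nonneg ht0.le _), ← Real.rpow_add ht0,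
      show -(1 + c) / 2 + (1 + c) / 2 = 0 by ring]
    simp
  have hvm : AEMeasurable v (volume.restrict (Set.Ioo x ε)) :=
    hg.enorm.mul (by fun_prop)
  have hcs := ENNReal.lintegral_mul_le_Lp_mul_Lq (volume.restrict (Set.Ioo x ε))
    Real.HolderConjugate.two_two (show AEMeasurable u _ by fun_prop) hvm
  have hsqrt : ∀ y : ENNReal, (y ^ (1 / 2 : ℝ)) ^ 2 = y := fun y => by
    rw [← ENNReal.rpow_natCast, ← ENNReal.rpow_mul]
    norm_num
  calc
    _ ≤ (∫⁻ t in Set.Ioo x ε, (u * v) t) ^ 2 := by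
      gcongr
      exact (enorm_integral_le_lintegral_enorm _).trans_eq huv
    _ ≤ (∫⁻ t in Set.Ioo x ε, u t ^ (2 : ℝ)) * ∫⁻ t in Set.Ioo x ε, v t ^ (2 : ℝ) := by
      refine (pow_le_pow_left' hcs 2).trans_eq ?_
      rw [mul_pow, hsqrt, hsqrt]
    _ ≤ _ := by
      simp only [ENNReal.rpow_two]
      gcongr ?_ * ?_
      · rw [← lintegral_Ioi_rpow_neg hx hc]
        refine (setLIntegral_congr_fun measurableSet_Ioo (hpow _)).trans_le ?_
        exact lintegral_mono_set Set.Ioo_subset_Ioi_self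
      · refine (setLIntegral_congr_fun measurableSet_Ioo fun t ht => ?_).le
        simp only [hv]
        rw [mul_pow, hpow _ t ht]

/-- The dual weighted Hardy inequality in `ℝ≥0∞`-valued form. -/
theorem lintegral_enorm_integral_Ioo_sq_le {E : Type*} [NormedAddCommGroup E] [NormedSpace ℝ E]
    {ε c : ℝ} (hc : 0 < c) {g : ℝ → E}
    (hg : AEStronglyMeasurable g (volume.restrict (Set.Ioo 0 ε))) :
    ∫⁻ x in Set.Ioo 0 ε, ‖∫ t in Set.Ioo x ε, g t‖ₑ ^ 2 * ENNReal.ofReal (x ^ (2 * c - 1)) ≤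
      (∫⁻ t in Set.Ioo 0 ε, ‖g t‖ₑ ^ 2 * ENNReal.ofReal (t ^ (1 + 2 * c))) *
        ENNReal.ofReal (1 / c ^ 2) := by
  calc
    _ ≤ ∫⁻ x in Set.Ioo 0 ε, (ENNReal.ofReal (1 / c) * ENNReal.ofReal (x ^ (c - 1))) *
          ∫⁻ t in Set.Ioo x ε, ‖g t‖ₑ ^ 2 * ENNReal.ofReal (t ^ (1 + c)) := by
      refine setLIntegral_mono' measurableSet_Ioo fun x hx => ?_
      have hgx := hg.mono_measure
        (Measure.restrict_mono (Set.Ioo_subset_Ioo_left hx.1.le) le_rfl)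
      refine (mul_le_mul_left (enorm_integral_Ioo_sq_le hx.1 hc hgx) _).trans_eq ?_
      rw [mul_right_comm, ← ENNReal.ofReal_mul (div_nonneg (Real.rpow_nonneg hx.1.le _) hc.le),
        ← ENNReal.ofReal_mul (by positivity), div_mul_eq_mul_div, ← Real.rpow_add hx.1,
        show -c + (2 * c - 1) = c - 1 by ring, one_div_mul_eq_div]
    _ = ∫⁻ t in Set.Ioo 0 ε, ‖g t‖ₑ ^ 2 * ENNReal.ofReal (t ^ (1 + c)) *
          ∫⁻ x in Set.Ioo 0 t, ENNReal.ofReal (1 / c) * ENNReal.ofReal (x ^ (c - 1)) :=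
      lintegral_Ioo_mul_lintegral_Ioo_swap (by fun_prop)
        ((hg.enorm.pow_const 2).mul (by fun_prop))
    _ = ∫⁻ t in Set.Ioo 0 ε, ‖g t‖ₑ ^ 2 * ENNReal.ofReal (t ^ (1 + 2 * c)) *
          ENNReal.ofReal (1 / c ^ 2) := by
      refine setLIntegral_congr_fun measurableSet_Ioo fun t ht => ?_
      have ht0 : 0 ≤ t ^ (1 + c) := Real.rpow_nonneg ht.1.le _
      have ht1 : 0 ≤ t ^ (1 + 2 * c) := Real.rpow_nonneg ht.1.le _
      change _ * _ * _ = _ * _ * _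
      rw [lintegral_const_mul _ (by fun_prop), lintegral_Ioo_zero_rpow ht.1 hc, mul_assoc,
        mul_assoc, ← ENNReal.ofReal_mul (by positivity), ← ENNReal.ofReal_mul ht0,
        ← ENNReal.ofReal_mul ht1, show 1 + 2 * c = (1 + c) + c by ring, Real.rpow_add ht.1 (1 + c)]
      congr 2
      field_simp
    _ = _ := lintegral_mul_const' _ _ ENNReal.ofReal_ne_top

theorem integrableOn_Ioo_of_sq_mul_rpow {E : Type*} [NormedAddCommGroup E]
    {x ε s : ℝ} (hx : 0 < x) (hs : 0 ≤ s) {g : ℝ → E}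
    (hg : AEStronglyMeasurable g (volume.restrict (Set.Ioo x ε)))
    (hA : IntegrableOn (fun t : ℝ => ‖g t‖ ^ 2 * t ^ s) (Set.Ioo x ε)) :
    IntegrableOn g (Set.Ioo x ε) := by
  have hconst : IntegrableOn (fun _ : ℝ => (1 : ℝ)) (Set.Ioo x ε) :=
    integrableOn_const measure_Ioo_lt_top.ne
  refine (hconst.add (hA.div_const (x ^ s))).mono' hg
    ((ae_restrict_iff' measurableSet_Ioo).2 (ae_of_all _ fun t ht => ?_))
  have hxs : 0 < x ^ s := Real.rpow_pos_of_pos hx _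
  have hle : ‖g t‖ ^ 2 ≤ ‖g t‖ ^ 2 * t ^ s / x ^ s := by
    rw [le_div_iff₀ hxs]
    gcongr
    exact ht.1.le
  simp only [Pi.add_apply]
  nlinarith [sq_nonneg (‖g t‖ - 1)]

theorem hasDerivAt_neg_integral_Ioo {E : Type*} [NormedAddCommGroup E] [NormedSpace ℝ E]
    [CompleteSpace E] {a x ε : ℝ} {g : ℝ → E} (hg : ContinuousOn g (Set.Ioo a ε))
    (hx : x ∈ Set.Ioo a ε) (hint : IntegrableOn g (Set.Ioo x ε)) :
    HasDerivAt (fun y : ℝ => -∫ t in Set.Ioo y ε, g t) (g x) x := by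
  have hi : IntervalIntegrable g volume x ε :=
    (intervalIntegrable_iff_integrableOn_Ioo_of_le hx.2.le).2 hint
  have hd := (intervalIntegral.integral_hasDerivAt_left hi
    (hg.stronglyMeasurableAtFilter isOpen_Ioo x hx) (hg.continuousAt (isOpen_Ioo.mem_nhds hx))).neg
  rw [neg_neg] at hd
  refine hd.congr_of_eventuallyEq ?_
  filter_upwards [isOpen_Ioo.mem_nhds hx] with y hy
  simp [intervalIntegral.integral_of_le hy.2.le, integral_Ioc_eq_integral_Ioo]

/-- Dual weighted Hardy inequality: if `g` is continuous on `(0, ε)` with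
`A = ∫₀^ε |g t|² t^(1-2b) dt < ∞` and `b < 0`, then `g` is integrable on `(x, ε)` for
every `x ∈ (0, ε)`, `f x := -∫ₓ^ε g t dt` satisfies `f' = g` on `(0, ε)`, and
`∫₀^ε |f x|² x^(-2b-1) dx ≤ A / b²`. -/
theorem weighted_hardy_inequality_dual (ε b : ℝ) (hε : 0 < ε) (hb : b < 0) (g : ℝ → ℂ)
    (hg : ContinuousOn g (Set.Ioo 0 ε))
    (hA : IntegrableOn (fun t : ℝ => ‖g t‖ ^ 2 * t ^ (1 - 2 * b)) (Set.Ioo 0 ε)) :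
    (∀ x ∈ Set.Ioo (0 : ℝ) ε, IntegrableOn g (Set.Ioo x ε)) ∧
    (∀ x ∈ Set.Ioo (0 : ℝ) ε,
      HasDerivAt (fun y : ℝ => -∫ t in Set.Ioo y ε, g t) (g x) x) ∧
    (∫⁻ x in Set.Ioo (0 : ℝ) ε,
        ENNReal.ofReal (‖-∫ t in Set.Ioo x ε, g t‖ ^ 2 * x ^ (-2 * b - 1))) ≤
      ENNReal.ofReal ((∫ t in Set.Ioo (0 : ℝ) ε, ‖g t‖ ^ 2 * t ^ (1 - 2 * b)) / b ^ 2) := by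
  have hgm : AEStronglyMeasurable g (volume.restrict (Set.Ioo 0 ε)) :=
    hg.aestronglyMeasurable measurableSet_Ioo
  have hint : ∀ x ∈ Set.Ioo (0 : ℝ) ε, IntegrableOn g (Set.Ioo x ε) := fun x hx =>
    have hsub : Set.Ioo x ε ⊆ Set.Ioo 0 ε := Set.Ioo_subset_Ioo_left hx.1.le
    integrableOn_Ioo_of_sq_mul_rpow hx.1 (by linarith)
      (hgm.mono_measure (Measure.restrict_mono hsub le_rfl)) (hA.mono_set hsub)
  refine ⟨hint, fun x hx => hasDerivAt_neg_integral_Ioo hg hx (hint x hx), ?_⟩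
  have hofReal : ∀ (z : ℂ) (r : ℝ),
      ENNReal.ofReal (‖z‖ ^ 2 * r) = ‖z‖ₑ ^ 2 * ENNReal.ofReal r := fun z r => by
    rw [ENNReal.ofReal_mul (by positivity), ENNReal.ofReal_pow (norm_nonneg _), ofReal_norm]
  have hmain := lintegral_enorm_integral_Ioo_sq_le (neg_pos.2 hb) hgm
  rw [div_eq_mul_one_div, ENNReal.ofReal_mul' (by positivity),
    ofReal_integral_eq_lintegral_ofReal hA ((ae_restrict_iff' measurableSet_Ioo).2
      (ae_of_all _ fun t ht => mul_nonneg (sq_nonneg _) (Real.rpow_nonneg ht.1.le _)))]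
  simp only [hofReal, norm_neg]
  rwa [neg_sq, show 2 * -b - 1 = -2 * b - 1 by ring, show 1 + 2 * -b = 1 - 2 * b by ring] at hmain
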